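/- Suppose (ξ₁, ξ₂) ~ N((πβ, π)', Σ) and the parameter space {(πβ, π) : π ∈ Π, β ∈ B} contains an open set in ℝ². Then any estimator β̂(ξ) satisfying E_{π,β}[β̂(ξ)] = β for all (π,β) in the parameter space equals β̂_U(ξ) almost surely for all such (π,β). -/

import Mathlib

open MeasureTheory ProbabilityTheory Filter

/-- Standard normal density `φ`. -/
noncomputable def stdPDF (x : ℝ) : ℝ :=
  (Real.sqrt (2 * Real.pi))⁻¹ * Real.exp (-(x ^ 2) / 2)

/-- Standard normal CDF `Φ`. -/
noncomputable def stdCDF (x : ℝ) : ℝ := ∫ t in Set.Iic x, stdPDF t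

/-- Mills-ratio estimator `τ̂(x, σ²) = (1/σ)(1 − Φ(x/σ))/φ(x/σ)`. -/
noncomputable def millsTau (σ x : ℝ) : ℝ :=
  (1 / σ) * (1 - stdCDF (x / σ)) / stdPDF (x / σ)

/-- The joint law of (ξ₁, ξ₂) ~ N((πβ, π)', Σ), realized as the image of two
independent standard normals. -/
noncomputable def ivLaw (σ₁ σ₁₂ σ₂ π β : ℝ) : Measure (ℝ × ℝ) :=
  ((gaussianReal 0 1).prod (gaussianReal 0 1)).map
    (fun z => (π * β + (σ₁₂ / σ₂) * z.2
        + Real.sqrt (σ₁ ^ 2 - σ₁₂ ^ 2 / σ₂ ^ 2) * z.1, π + σ₂ * z.2))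


open scoped Topology ENNReal

/-- Equality of moment generating functions near zero gives equality at `I`. -/
lemma aux_complexMGF {Ω : Type*} {m : MeasurableSpace Ω} {μ μ' : Measure Ω}
    {X : Ω → ℝ} {δ : ℝ} (hδ : 0 < δ)
    (h1 : ∀ t : ℝ, |t| < δ → Integrable (fun ω => Real.exp (t * X ω)) μ)
    (h2 : ∀ t : ℝ, |t| < δ → Integrable (fun ω => Real.exp (t * X ω)) μ')
    (h : ∀ t : ℝ, |t| < δ → mgf X μ t = mgf X μ' t) :
    complexMGF X μ Complex.I = complexMGF X μ' Complex.I := by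
  have key : ∀ ν : Measure Ω, (∀ t : ℝ, |t| < δ → Integrable (fun ω => Real.exp (t * X ω)) ν) →
      AnalyticOnNhd ℂ (complexMGF X ν) {z : ℂ | z.re ∈ Set.Ioo (-δ) δ} := by
    intro ν hν z hz
    apply analyticAt_complexMGF
    have : Set.Ioo (-δ) δ ⊆ interior (integrableExpSet X ν) := by
      apply interior_maximal _ isOpen_Ioo
      intro t ht
      exact hν t (abs_lt.2 ht)
    exact this hz
  have := AnalyticOnNhd.eqOn_of_preconnected_of_frequently_eq (key μ h1) (key μ' h2)
    ((convex_Ioo (-δ) δ).linear_preimage Complex.reLm).isPreconnected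
    (z₀ := ((0:ℝ) : ℂ)) (by simp [hδ]) ?_
  · exact this (by simp [hδ])
  have h_real : ∃ᶠ (x : ℝ) in 𝓝[≠] 0, complexMGF X μ x = complexMGF X μ' x := by
    apply Eventually.frequently
    apply eventually_nhdsWithin_of_eventually_nhds
    have : Set.Ioo (-δ) δ ∈ 𝓝 (0:ℝ) := Ioo_mem_nhds (by linarith) hδ
    filter_upwards [this] with y hy
    rw [complexMGF_ofReal, complexMGF_ofReal, h y (abs_lt.2 hy)]
  rw [frequently_iff_seq_forall] at h_real ⊢
  obtain ⟨xs, hx_tendsto, hx_eq⟩ := h_real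
  refine ⟨fun n ↦ xs n, ?_, fun n ↦ ?_⟩
  · rw [tendsto_nhdsWithin_iff] at hx_tendsto ⊢
    constructor
    · exact (Complex.continuous_ofReal.tendsto 0).comp hx_tendsto.1
    · simpa using hx_tendsto.2
  · simp [hx_eq]

lemma aux_shift1 (a : ℝ) : (gaussianReal 0 1).map (fun x => x + a) =
    (gaussianReal 0 1).withDensity (fun x => ENNReal.ofReal (Real.exp (a * x - a ^ 2 / 2))) := by
  rw [gaussianReal_map_add_const, gaussianReal_of_var_ne_zero _ one_ne_zero,
    gaussianReal_of_var_ne_zero _ one_ne_zero,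
    ← withDensity_mul _ (measurable_gaussianPDF 0 1) (by fun_prop)]
  congr 1
  ext x
  simp only [Pi.mul_apply, gaussianPDF]
  rw [← ENNReal.ofReal_mul (gaussianPDFReal_nonneg _ _ _)]
  congr 1
  simp only [gaussianPDFReal]
  rw [mul_assoc _ (Real.exp (-(x - 0) ^ 2 / _)), ← Real.exp_add]
  congr 2
  simp
  ring

/-- Cameron–Martin for the standard Gaussian on the plane. -/
lemma aux_shift2 (a : ℝ × ℝ) :
    ((gaussianReal 0 1).prod (gaussianReal 0 1)).map (fun z : ℝ × ℝ => z + a) =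
    ((gaussianReal 0 1).prod (gaussianReal 0 1)).withDensity
      (fun z => ENNReal.ofReal (Real.exp (-(a.1 ^ 2 + a.2 ^ 2) / 2) *
        Real.exp (a.1 * z.1 + a.2 * z.2))) := by
  have h := Measure.map_prod_map (gaussianReal 0 1) (gaussianReal 0 1)
    (f := fun x : ℝ => x + a.1) (g := fun x : ℝ => x + a.2) (by fun_prop) (by fun_prop)
  have e : (fun z : ℝ × ℝ => z + a) = Prod.map (fun x : ℝ => x + a.1) (fun x : ℝ => x + a.2) := by
    ext z <;> simp
  rw [e, ← h, aux_shift1, aux_shift1]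
  rw [prod_withDensity (by fun_prop) (by fun_prop)]
  congr 1
  ext z
  rw [← ENNReal.ofReal_mul (Real.exp_nonneg _), ← Real.exp_add, ← Real.exp_add]
  congr 2
  ring

/-- Completeness of the bivariate normal location family. -/
lemma aux_complete (h : ℝ × ℝ → ℝ) (hm : Measurable h)
    (H : ∀ᶠ a in 𝓝 (0 : ℝ × ℝ),
      Integrable (fun z => h (z + a)) ((gaussianReal 0 1).prod (gaussianReal 0 1)) ∧
      ∫ z, h (z + a) ∂((gaussianReal 0 1).prod (gaussianReal 0 1)) = 0) :
    ∀ᵐ z ∂((gaussianReal 0 1).prod (gaussianReal 0 1)), h z = 0 := by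
  set γ := (gaussianReal 0 1).prod (gaussianReal 0 1) with hγ
  have H2 : ∀ᶠ a in 𝓝 (0 : ℝ × ℝ),
      Integrable (fun z => Real.exp (a.1 * z.1 + a.2 * z.2) * h z) γ ∧
      ∫ z, Real.exp (a.1 * z.1 + a.2 * z.2) * h z ∂γ = 0 := by
    filter_upwards [H] with a ha
    have hc : Real.exp (-(a.1 ^ 2 + a.2 ^ 2) / 2) ≠ 0 := (Real.exp_pos _).ne'
    have hmap : Measurable (fun z : ℝ × ℝ => z + a) := by fun_prop
    obtain ⟨hi, h0⟩ := ha
    have hi' : Integrable h (γ.map (fun z : ℝ × ℝ => z + a)) :=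
      (integrable_map_measure hm.aestronglyMeasurable hmap.aemeasurable).2 hi
    rw [← integral_map (f := h) hmap.aemeasurable hm.aestronglyMeasurable] at h0
    rw [aux_shift2] at hi' h0
    rw [integrable_withDensity_iff_integrable_smul' (by fun_prop) (by simp)] at hi'
    rw [integral_withDensity_eq_integral_toReal_smul (by fun_prop) (by simp)] at h0
    have e : ∀ z : ℝ × ℝ, (ENNReal.ofReal (Real.exp (-(a.1 ^ 2 + a.2 ^ 2) / 2) *
        Real.exp (a.1 * z.1 + a.2 * z.2))).toReal • h z =
        Real.exp (-(a.1 ^ 2 + a.2 ^ 2) / 2) * (Real.exp (a.1 * z.1 + a.2 * z.2) * h z) := by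
      intro z
      rw [ENNReal.toReal_ofReal (by positivity), smul_eq_mul, mul_assoc]
    simp only [e] at hi' h0
    rw [integral_const_mul] at h0
    refine ⟨?_, by simpa [hc] using h0⟩
    rwa [integrable_const_mul_iff (isUnit_iff_ne_zero.2 hc)] at hi'
  have hint0 : Integrable h γ := by simpa using H2.self_of_nhds.1
  let p : ℝ × ℝ → ℝ≥0∞ := fun z => ENNReal.ofReal (h z)
  let q : ℝ × ℝ → ℝ≥0∞ := fun z => ENNReal.ofReal (-h z)
  have hp : Measurable p := by fun_prop
  have hq : Measurable q := by fun_prop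
  have hpt : ∫⁻ z, p z ∂γ ≠ ∞ := (Integrable.lintegral_lt_top hint0).ne
  have hqt : ∫⁻ z, q z ∂γ ≠ ∞ := (Integrable.lintegral_lt_top hint0.neg).ne
  have : IsFiniteMeasure (γ.withDensity p) := isFiniteMeasure_withDensity hpt
  have : IsFiniteMeasure (γ.withDensity q) := isFiniteMeasure_withDensity hqt
  have heq : γ.withDensity p = γ.withDensity q := by
    apply Measure.ext_of_charFunDual
    ext L
    rw [charFunDual_apply, charFunDual_apply]
    have hL : ∀ z : ℝ × ℝ, L z = L (1, 0) * z.1 + L (0, 1) * z.2 := by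
      intro z
      have : z = z.1 • ((1:ℝ), (0:ℝ)) + z.2 • ((0:ℝ), (1:ℝ)) := by ext <;> simp
      conv_lhs => rw [this]
      rw [map_add, map_smul, map_smul]
      simp [mul_comm]
    have hcont : Tendsto (fun t : ℝ => (t * L (1, 0), t * L (0, 1))) (𝓝 0) (𝓝 (0 : ℝ × ℝ)) := by
      have : Continuous (fun t : ℝ => (t * L (1, 0), t * L (0, 1))) := by fun_prop
      have := this.tendsto 0
      simpa [← Prod.zero_eq_mk] using this
    have H3 := hcont.eventually H2
    obtain ⟨δ, hδ, H4⟩ := Metric.eventually_nhds_iff.1 H3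
    have H5 : ∀ t : ℝ, |t| < δ → Integrable (fun z => Real.exp (t * L z) * h z) γ ∧
        ∫ z, Real.exp (t * L z) * h z ∂γ = 0 := by
      intro t ht
      have := H4 (y := t) (by simpa using ht)
      have e : ∀ z : ℝ × ℝ, t * L z = t * L (1, 0) * z.1 + t * L (0, 1) * z.2 := by
        intro z; rw [hL]; ring
      have e' : (fun z => Real.exp (t * L z) * h z) =
          fun z => Real.exp (t * L (1, 0) * z.1 + t * L (0, 1) * z.2) * h z := by
        ext z; rw [e z]
      rw [e']
      exact this
    have hint : ∀ f : ℝ × ℝ → ℝ, Measurable f → (∀ z, |f z| ≤ |h z|) → ∀ t : ℝ, |t| < δ →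
        Integrable (fun z => (ENNReal.ofReal (f z)).toReal • Real.exp (t * L z)) γ := by
      intro f hf hfh t ht
      refine (H5 t ht).1.mono (by fun_prop) (ae_of_all _ fun z => ?_)
      rw [smul_eq_mul, mul_comm, norm_mul, norm_mul]
      gcongr
      refine le_trans ?_ (hfh z)
      rw [ENNReal.toReal_ofReal', Real.norm_eq_abs]
      exact abs_max_le_max_abs_abs.trans (by simp)
    have hip := hint h hm (fun _ => le_rfl)
    have hiq := hint (fun z => -h z) hm.neg (fun _ => by simp)
    have := aux_complexMGF (μ := γ.withDensity p) (μ' := γ.withDensity q) (X := L) hδ ?_ ?_ ?_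
    · simpa [complexMGF, mul_comm] using this
    · intro t ht
      rw [integrable_withDensity_iff_integrable_smul' hp (by simp [p])]
      exact hip t ht
    · intro t ht
      rw [integrable_withDensity_iff_integrable_smul' hq (by simp [q])]
      exact hiq t ht
    · intro t ht
      rw [mgf, mgf, integral_withDensity_eq_integral_toReal_smul hp (by simp [p]),
        integral_withDensity_eq_integral_toReal_smul hq (by simp [q]), ← sub_eq_zero,
        ← integral_sub (hip t ht) (hiq t ht), ← (H5 t ht).2]
      congr 1
      ext z
      rw [← sub_smul, ENNReal.toReal_ofReal', ENNReal.toReal_ofReal', smul_eq_mul, mul_comm]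
      congr 1
      rcases le_total 0 (h z) with h0 | h0 <;> simp [h0]
  have := (withDensity_eq_iff hp.aemeasurable hq.aemeasurable hpt).1 heq
  filter_upwards [this] with z hz
  simp only [p, q] at hz
  rcases lt_trichotomy (h z) 0 with h0 | h0 | h0
  · rw [ENNReal.ofReal_of_nonpos h0.le] at hz
    have := ENNReal.ofReal_eq_zero.1 hz.symm
    linarith
  · exact h0
  · rw [ENNReal.ofReal_of_nonpos (p := - h z) (by linarith)] at hz
    have := ENNReal.ofReal_eq_zero.1 hz
    linarith

lemma stdPDF_eq (x : ℝ) : stdPDF x = gaussianPDFReal 0 1 x := by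
  simp [stdPDF, gaussianPDFReal]

lemma stdPDF_eq' : stdPDF = gaussianPDFReal 0 1 := funext stdPDF_eq

lemma stdPDF_pos (x : ℝ) : 0 < stdPDF x := by
  rw [stdPDF_eq]; exact gaussianPDFReal_pos _ _ _ one_ne_zero

lemma one_sub_stdCDF (u : ℝ) : 1 - stdCDF u = ∫ t in Set.Ioi u, stdPDF t := by
  rw [stdCDF, stdPDF_eq', ← integral_gaussianPDFReal_eq_one 0 (v := 1) one_ne_zero,
    ← intervalIntegral.integral_Iic_add_Ioi (b := u)
      (integrable_gaussianPDFReal 0 1).integrableOn (integrable_gaussianPDFReal 0 1).integrableOn]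
  ring

lemma measurable_stdCDF : Measurable stdCDF := by
  apply Monotone.measurable
  intro x y hxy
  simp only [stdCDF, stdPDF_eq']
  apply setIntegral_mono_set (integrable_gaussianPDFReal 0 1).integrableOn
    (ae_of_all _ fun x => gaussianPDFReal_nonneg _ _ _)
  exact (Set.Iic_subset_Iic.2 hxy).eventuallyLE

lemma measurable_stdPDF : Measurable stdPDF := by
  rw [stdPDF_eq']; exact measurable_gaussianPDFReal 0 1

lemma one_sub_stdCDF_nonneg (u : ℝ) : 0 ≤ 1 - stdCDF u := by
  rw [one_sub_stdCDF]
  exact integral_nonneg fun x => (stdPDF_pos x).le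

lemma ofReal_one_sub_stdCDF (u : ℝ) : ENNReal.ofReal (1 - stdCDF u) =
    ∫⁻ t in Set.Ioi u, ENNReal.ofReal (stdPDF t) := by
  rw [one_sub_stdCDF, ofReal_integral_eq_lintegral_ofReal]
  · rw [stdPDF_eq']; exact (integrable_gaussianPDFReal 0 1).integrableOn
  · exact ae_of_all _ fun x => (stdPDF_pos x).le

lemma pdf_shift (m u : ℝ) :
    gaussianPDFReal m 1 u = stdPDF u * (Real.exp (-m ^ 2 / 2) * Real.exp (m * u)) := by
  simp only [gaussianPDFReal, stdPDF]
  rw [mul_assoc _ (Real.exp (-u ^ 2 / 2)), ← Real.exp_add, ← Real.exp_add]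
  congr 1
  · simp
  congr 1
  simp
  ring

lemma lint_mills (m : ℝ) (hm : 0 < m) :
    ∫⁻ u, ENNReal.ofReal ((1 - stdCDF u) / stdPDF u) ∂(gaussianReal m 1)
      = ENNReal.ofReal (1 / m) := by
  have mP := measurable_stdPDF
  have mC := measurable_stdCDF
  rw [gaussianReal_of_var_ne_zero _ one_ne_zero,
    lintegral_withDensity_eq_lintegral_mul _ (measurable_gaussianPDF m 1) (by fun_prop)]
  set e : ℝ → ℝ := fun u => Real.exp (-m ^ 2 / 2) * Real.exp (m * u) with he
  have me : Measurable e := by fun_prop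
  have e0 : ∀ u, 0 ≤ e u := fun u => by positivity
  calc _ = ∫⁻ u, ENNReal.ofReal (e u) * ENNReal.ofReal (1 - stdCDF u) := by
        congr 1; ext u
        simp only [Pi.mul_apply, gaussianPDF]
        rw [← ENNReal.ofReal_mul (gaussianPDFReal_nonneg _ _ _), ← ENNReal.ofReal_mul (e0 u),
          pdf_shift]
        congr 1
        have := (stdPDF_pos u).ne'
        simp only [he]
        field_simp
    _ = ∫⁻ u, ∫⁻ t, (Set.Ioi u).indicator
          (fun t => ENNReal.ofReal (e u) * ENNReal.ofReal (stdPDF t)) t := by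
        congr 1; ext u
        rw [ofReal_one_sub_stdCDF, lintegral_indicator measurableSet_Ioi,
          lintegral_const_mul _ (by fun_prop)]
    _ = ∫⁻ t, ∫⁻ u, (Set.Ioi u).indicator
          (fun t => ENNReal.ofReal (e u) * ENNReal.ofReal (stdPDF t)) t := by
        apply lintegral_lintegral_swap
        apply Measurable.aemeasurable
        have : Function.uncurry (fun u t => (Set.Ioi u).indicator
          (fun t => ENNReal.ofReal (e u) * ENNReal.ofReal (stdPDF t)) t) =
          {x : ℝ × ℝ | x.1 < x.2}.indicator
            (fun x => ENNReal.ofReal (e x.1) * ENNReal.ofReal (stdPDF x.2)) := by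
          ext x
          simp [Function.uncurry, Set.indicator]
        rw [this]
        exact Measurable.indicator (by fun_prop) (measurableSet_lt measurable_fst measurable_snd)
    _ = ∫⁻ t, ENNReal.ofReal (1 / m) * gaussianPDF m 1 t := by
        congr 1; ext t
        have : ∀ u, (Set.Ioi u).indicator
          (fun t => ENNReal.ofReal (e u) * ENNReal.ofReal (stdPDF t)) t =
          (Set.Iio t).indicator
          (fun u => ENNReal.ofReal (e u) * ENNReal.ofReal (stdPDF t)) u := by
          intro u; simp [Set.indicator]
        simp only [this]
        rw [lintegral_indicator measurableSet_Iio, lintegral_mul_const _ (by fun_prop),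
          ← ofReal_integral_eq_lintegral_ofReal, ← integral_Iic_eq_integral_Iio]
        · simp only [he]
          rw [integral_const_mul, integral_exp_mul_Iic hm, gaussianPDF, pdf_shift,
            ← ENNReal.ofReal_mul (by positivity), ← ENNReal.ofReal_mul (by positivity)]
          congr 1
          field_simp
        · exact ((integrableOn_exp_mul_Iic hm t).mono_set Set.Iio_subset_Iic_self).const_mul _
        · exact ae_of_all _ e0
    _ = _ := by
        rw [lintegral_const_mul _ (measurable_gaussianPDF m 1),
          lintegral_gaussianPDF_eq_one _ one_ne_zero, mul_one]

lemma mills_int (m : ℝ) (hm : 0 < m) :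
    Integrable (fun u => (1 - stdCDF u) / stdPDF u) (gaussianReal m 1) ∧
    ∫ u, (1 - stdCDF u) / stdPDF u ∂(gaussianReal m 1) = 1 / m := by
  have mP := measurable_stdPDF
  have mC := measurable_stdCDF
  have h0 : ∀ u, 0 ≤ (1 - stdCDF u) / stdPDF u := fun u =>
    div_nonneg (one_sub_stdCDF_nonneg u) (stdPDF_pos u).le
  have hmeas : Measurable (fun u => (1 - stdCDF u) / stdPDF u) := by fun_prop
  constructor
  · refine ⟨hmeas.aestronglyMeasurable, ?_⟩
    rw [hasFiniteIntegral_iff_ofReal (ae_of_all _ h0), lint_mills m hm]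
    exact ENNReal.ofReal_lt_top
  · rw [integral_eq_lintegral_of_nonneg_ae (ae_of_all _ h0) hmeas.aestronglyMeasurable,
      lint_mills m hm, ENNReal.toReal_ofReal (by positivity)]

lemma mills_tau (σ π : ℝ) (hσ : 0 < σ) (hπ : 0 < π) :
    Integrable (fun z => millsTau σ (π + σ * z)) (gaussianReal 0 1) ∧
    ∫ z, millsTau σ (π + σ * z) ∂(gaussianReal 0 1) = 1 / π := by
  have mP := measurable_stdPDF
  have mC := measurable_stdCDF
  have hmeas : Measurable (fun u => (1 - stdCDF u) / stdPDF u) := by fun_prop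
  obtain ⟨h1, h2⟩ := mills_int (π / σ) (by positivity)
  have e : gaussianReal (π / σ) 1 = (gaussianReal 0 1).map (fun x => x + π / σ) := by
    rw [gaussianReal_map_add_const, zero_add]
  have hs : Measurable (fun x : ℝ => x + π / σ) := by fun_prop
  rw [e] at h1 h2
  rw [integrable_map_measure hmeas.aestronglyMeasurable hs.aemeasurable] at h1
  rw [integral_map hs.aemeasurable hmeas.aestronglyMeasurable] at h2
  have e2 : ∀ z, millsTau σ (π + σ * z) =
      (1 / σ) * ((1 - stdCDF (z + π / σ)) / stdPDF (z + π / σ)) := by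
    intro z
    have : (π + σ * z) / σ = z + π / σ := by field_simp; ring
    rw [millsTau, this, mul_div_assoc]
  simp only [e2]
  refine ⟨h1.const_mul _, ?_⟩
  rw [integral_const_mul, h2]
  field_simp

/-- Uniqueness: if the parameter space contains an open set, any unbiased estimator
equals β̂_U almost surely at every parameter value. -/
theorem stmt11 (σ₁ σ₁₂ σ₂ : ℝ) (hσ₂ : 0 < σ₂)
    (hpd : σ₁₂ ^ 2 < σ₁ ^ 2 * σ₂ ^ 2)
    (Pi B : Set ℝ) (hPi : Pi ⊆ Set.Ioi 0)
    (hopen : ∃ U : Set (ℝ × ℝ), IsOpen U ∧ U.Nonempty ∧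
        U ⊆ {p | ∃ π ∈ Pi, ∃ β ∈ B, p = (π * β, π)})
    (b : ℝ × ℝ → ℝ) (hb : Measurable b)
    (hunb : ∀ π ∈ Pi, ∀ β ∈ B,
        Integrable b (ivLaw σ₁ σ₁₂ σ₂ π β) ∧ ∫ x, b x ∂(ivLaw σ₁ σ₁₂ σ₂ π β) = β) :
    ∀ π ∈ Pi, ∀ β ∈ B, ∀ᵐ x ∂(ivLaw σ₁ σ₁₂ σ₂ π β),
      b x = millsTau σ₂ x.2 * (x.1 - (σ₁₂ / σ₂ ^ 2) * x.2) + σ₁₂ / σ₂ ^ 2 := by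
  have mP := measurable_stdPDF
  have mC := measurable_stdCDF
  have mM : Measurable (millsTau σ₂) := by unfold millsTau; fun_prop
  set s := Real.sqrt (σ₁ ^ 2 - σ₁₂ ^ 2 / σ₂ ^ 2) with hs
  have hs0 : 0 < s := by
    apply Real.sqrt_pos.2
    rw [sub_pos, div_lt_iff₀ (by positivity)]
    exact hpd
  set k := σ₁₂ / σ₂ ^ 2 with hk
  have hk2 : σ₁₂ / σ₂ = k * σ₂ := by rw [hk]; field_simp
  set γ := (gaussianReal 0 1).prod (gaussianReal 0 1) with hγ
  let T : ℝ × ℝ → ℝ × ℝ → ℝ × ℝ := fun θ z =>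
    (θ.1 + (σ₁₂ / σ₂) * z.2 + s * z.1, θ.2 + σ₂ * z.2)
  have hT : ∀ θ, Measurable (T θ) := fun θ => by fun_prop
  have hlaw : ∀ π β, ivLaw σ₁ σ₁₂ σ₂ π β = γ.map (T (π * β, π)) := fun π β => rfl
  let g : ℝ × ℝ → ℝ := fun x => b x - (millsTau σ₂ x.2 * (x.1 - k * x.2) + k)
  have hg : Measurable g := by fun_prop
  have hgint : ∀ π ∈ Pi, ∀ β ∈ B, Integrable (fun z => g (T (π * β, π) z)) γ ∧
      ∫ z, g (T (π * β, π) z) ∂γ = 0 := by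
    intro π hπ β hβ
    have hπ0 : 0 < π := hPi hπ
    obtain ⟨h1, h2⟩ := hunb π hπ β hβ
    rw [hlaw] at h1 h2
    rw [integrable_map_measure hb.aestronglyMeasurable (hT _).aemeasurable] at h1
    rw [integral_map (hT _).aemeasurable hb.aestronglyMeasurable] at h2
    obtain ⟨h3, h4⟩ := mills_tau σ₂ π hσ₂ hπ0
    have hid : Integrable (fun x : ℝ => x) (gaussianReal 0 1) :=
      memLp_one_iff_integrable.1 (memLp_id_gaussianReal 1)
    have h5 : Integrable (fun x : ℝ => π * β - k * π + s * x) (gaussianReal 0 1) :=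
      (integrable_const _).add (hid.const_mul _)
    have h6 : ∫ x, (π * β - k * π + s * x) ∂(gaussianReal 0 1) = π * β - k * π := by
      rw [integral_add (integrable_const _) (hid.const_mul _), integral_const_mul,
        integral_id_gaussianReal]
      simp
    have h7 := h5.mul_prod h3
    have h8 := integral_prod_mul (μ := gaussianReal 0 1) (ν := gaussianReal 0 1)
      (fun x : ℝ => π * β - k * π + s * x) (fun z => millsTau σ₂ (π + σ₂ * z))
    rw [h6, h4] at h8
    have e : ∀ z : ℝ × ℝ, g (T (π * β, π) z) = b (T (π * β, π) z) -
        ((π * β - k * π + s * z.1) * millsTau σ₂ (π + σ₂ * z.2) + k) := by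
      intro z
      simp only [g, T, hk2]
      ring
    simp only [e]
    have h9 : Integrable (fun z : ℝ × ℝ =>
        (π * β - k * π + s * z.1) * millsTau σ₂ (π + σ₂ * z.2) + k) γ :=
      h7.add (integrable_const k)
    have h1 : Integrable (fun z => b (T (π * β, π) z)) γ := h1
    refine ⟨h1.sub h9, ?_⟩
    rw [integral_sub h1 h9, h2, integral_add h7 (integrable_const k), h8]
    simp
    field_simp
    ring
  obtain ⟨U, hU, ⟨θ, hθ⟩, hUs⟩ := hopen
  have hmain := aux_complete (fun z => g (T θ z)) (hg.comp (hT θ)) ?_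
  · intro π hπ β hβ
    rw [hlaw, ae_map_iff (hT _).aemeasurable (measurableSet_eq_fun hb (by fun_prop))]
    let a2 : ℝ := (π - θ.2) / σ₂
    let a : ℝ × ℝ := ((π * β - θ.1 - (σ₁₂ / σ₂) * a2) / s, a2)
    have hac : γ.map (fun z : ℝ × ℝ => z + a) ≪ γ := by
      rw [hγ, aux_shift2]
      exact withDensity_absolutelyContinuous _ _
    have h1 := hac.ae_le hmain
    have h2 := ae_of_ae_map (by fun_prop) h1
    filter_upwards [h2] with z hz
    have e : T θ (z + a) = T (π * β, π) z := by
      simp only [T, a, a2, Prod.fst_add, Prod.snd_add]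
      ext
      · simp only; field_simp; ring
      · simp only; field_simp; ring
    rw [e] at hz
    exact sub_eq_zero.1 hz
  · let A : ℝ × ℝ → ℝ × ℝ := fun a => (θ.1 + (σ₁₂ / σ₂) * a.2 + s * a.1, θ.2 + σ₂ * a.2)
    have hA : Continuous A := by fun_prop
    have hA0 : A 0 = θ := by ext <;> simp [A]
    have : ∀ᶠ a in 𝓝 (0 : ℝ × ℝ), A a ∈ U :=
      hA.continuousAt.eventually (by rw [hA0]; exact hU.mem_nhds hθ)
    filter_upwards [this] with a ha
    obtain ⟨π, hπ, β, hβ, hpe⟩ := hUs ha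
    have e : ∀ z, T θ (z + a) = T (π * β, π) z := by
      intro z
      rw [← hpe]
      simp only [T, A, Prod.fst_add, Prod.snd_add]
      ext
      · simp only; ring
      · simp only; ring
    simp only [e]
    exact hgint π hπ β hβ
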